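/- Let r ∈ (2,∞) and let f₁, f₂ be Schwartz functions on ℝ. There exist measurable functions K : ℝ → ℕ, N₀(x) ≤ N₁(x) ≤ ⋯ and d₀(x), d₁(x), … such that: (i) Σ_{j≥0} |d_j(x)|^{r/(r−2)} = 1 for every x; (ii) for every x, if j > K(x) then d_j(x) = 0 and N_j(x) = N_{j−1}(x); and (iii) for every x ∈ ℝ, |T_r(f₁,f₂)(x)| ≤ C_r B_r(f₁,f₂)(x), where B_r(f₁,f₂)(x) := Σ_{j=1}^{K(x)} d_j(x) ∬_{N_{j−1}(x) < ξ₁ < ξ₂ < N_j(x)} f̂₁(ξ₁) f̂₂(ξ₂) e^{ix(ξ₁+ξ₂)} dξ₁ dξ₂ and C_r depends only on r. -/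

import Mathlib

open MeasureTheory Complex SchwartzMap
open scoped ENNReal

noncomputable section

/-- The Fourier transform with the paper's normalization
`f̂(ξ) = (2π)^{-1/2} ∫ f(x) e^{-i x ξ} dx`. -/
def ftx (f : ℝ → ℂ) (ξ : ℝ) : ℂ :=
  ((2 * Real.pi) ^ (-(1/2 : ℝ)) : ℝ) * ∫ x : ℝ, f x * Complex.exp (-(Complex.I * x * ξ))

/-- The truncated bilinear Fourier integral
`∬_{a < ξ₁ < ξ₂ < b} f̂₁(ξ₁) f̂₂(ξ₂) e^{i x (ξ₁+ξ₂)} dξ₁ dξ₂`. -/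
def bfi (f₁ f₂ : ℝ → ℂ) (a b : ℝ) (x : ℝ) : ℂ :=
  ∫ p : ℝ × ℝ in {p : ℝ × ℝ | a < p.1 ∧ p.1 < p.2 ∧ p.2 < b},
    ftx f₁ p.1 * ftx f₂ p.2 * Complex.exp (Complex.I * x * (p.1 + p.2))

/-- The variation sum operator `T_r`. -/
def Tr (r : ℝ) (f₁ f₂ : ℝ → ℂ) (x : ℝ) : ℝ≥0∞ :=
  ⨆ (K : ℕ) (N : ℕ → ℝ) (_ : StrictMono N),
    (∑ j ∈ Finset.range K,
        (ENNReal.ofReal ‖bfi f₁ f₂ (N j) (N (j + 1)) x‖) ^ (r / 2)) ^ (2 / r)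

/-- A supremum of lower semicontinuous functions is attained along a sequence of the family. -/
theorem exists_seq_iSup_eq_of_lowerSemicontinuous {X ι : Type*} [TopologicalSpace X]
    [HereditarilyLindelofSpace X] [Nonempty ι] (S : ι → X → ℝ≥0∞)
    (hS : ∀ i, LowerSemicontinuous (S i)) :
    ∃ u : ℕ → ι, ∀ x, ⨆ i, S i x = ⨆ n, S (u n) x := by
  have hlub : IsLUB (Set.range S) (⨆ i, S i) := isLUB_iSup
  obtain ⟨F, hFsub, hFc, hF⟩ := exists_countable_lowerSemicontinuous_isLUB
    (by rintro _ ⟨i, rfl⟩; exact hS i) hlub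
  obtain ⟨i₀⟩ := ‹Nonempty ι›
  obtain ⟨g, hg⟩ := (hFc.insert (S i₀)).exists_eq_range (Set.insert_nonempty _ _)
  have hmem : ∀ n, ∃ i, S i = g n := fun n => by
    have : g n ∈ insert (S i₀) F := hg ▸ Set.mem_range_self n
    rcases this with h | h
    · exact ⟨i₀, h.symm⟩
    · exact hFsub h
  choose u hu using hmem
  refine ⟨u, fun x => le_antisymm ?_ (iSup_le fun n => le_iSup (fun i => S i x) (u n))⟩
  have hle : (⨆ i, S i) ≤ fun x => ⨆ n, S (u n) x := by
    refine hF.2 fun f hf y => ?_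
    obtain ⟨n, rfl⟩ : f ∈ Set.range g := hg ▸ Set.mem_insert_of_mem _ hf
    rw [← hu n]
    exact le_iSup (fun n => S (u n) y) n
  simpa using hle x

/-- The Fourier transform of a Schwartz function is integrable. -/
theorem integrable_ftx (f : 𝓢(ℝ, ℂ)) : Integrable (ftx f) := by
  have h : ∀ ξ, ftx f ξ = ((2 * Real.pi) ^ (-(1/2 : ℝ)) : ℝ) *
      (FourierTransform.fourier f : 𝓢(ℝ, ℂ)) (ξ / (2 * Real.pi)) := fun ξ => by
    rw [SchwartzMap.fourier_coe, Real.fourier_real_eq_integral_exp_smul, ftx]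
    congr 2
    ext v
    rw [smul_eq_mul, mul_comm]
    congr 2
    have : (Real.pi : ℂ) ≠ 0 := by exact_mod_cast Real.pi_ne_zero
    push_cast
    field_simp
  rw [funext h]
  exact ((SchwartzMap.integrable _).comp_div (by positivity)).const_mul _

/-- The tensor product of the two Fourier transforms is integrable on the plane. -/
theorem integrable_ftx_mul_ftx (f₁ f₂ : 𝓢(ℝ, ℂ)) :
    Integrable fun p : ℝ × ℝ => ftx f₁ p.1 * ftx f₂ p.2 :=
  (integrable_ftx f₁).mul_prod (integrable_ftx f₂)

theorem norm_exp_I_mul_mul_add (x a b : ℝ) : ‖Complex.exp (Complex.I * x * (a + b))‖ = 1 := by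
  have : Complex.I * x * (a + b) = ((x * (a + b) : ℝ) : ℂ) * Complex.I := by push_cast; ring
  rw [this, Complex.norm_exp_ofReal_mul_I]

/-- The truncated bilinear Fourier integral depends continuously on the point. -/
theorem continuous_bfi (f₁ f₂ : 𝓢(ℝ, ℂ)) (a b : ℝ) : Continuous (bfi f₁ f₂ a b) := by
  have hi := (integrable_ftx_mul_ftx f₁ f₂).restrict
    (s := {p : ℝ × ℝ | a < p.1 ∧ p.1 < p.2 ∧ p.2 < b})
  refine continuous_of_dominated (bound := fun p => ‖ftx f₁ p.1 * ftx f₂ p.2‖) (fun x => ?_)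
    (fun x => ?_) hi.norm (Filter.Eventually.of_forall fun p => by fun_prop)
  · exact hi.aestronglyMeasurable.mul (by fun_prop : Continuous _).aestronglyMeasurable
  · refine Filter.Eventually.of_forall fun p => ?_
    rw [norm_mul, norm_exp_I_mul_mul_add, mul_one]

theorem measurableSet_simplex (a b : ℝ) :
    MeasurableSet {p : ℝ × ℝ | a < p.1 ∧ p.1 < p.2 ∧ p.2 < b} :=
  ((isOpen_lt continuous_const continuous_fst).inter
    ((isOpen_lt continuous_fst continuous_snd).inter
      (isOpen_lt continuous_snd continuous_const))).measurableSet

/-- The truncated integrals over consecutive intervals are summable with a uniform bound. -/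
theorem sum_enorm_bfi_le (f₁ f₂ : 𝓢(ℝ, ℂ)) (K : ℕ) {N : ℕ → ℝ} (hN : StrictMono N) (x : ℝ) :
    ∑ j ∈ Finset.range K, ‖bfi f₁ f₂ (N j) (N (j + 1)) x‖ₑ
      ≤ ∫⁻ p : ℝ × ℝ, ‖ftx f₁ p.1 * ftx f₂ p.2‖ₑ := by
  set A : ℕ → Set (ℝ × ℝ) := fun j => {p | N j < p.1 ∧ p.1 < p.2 ∧ p.2 < N (j + 1)}
  have hd : Pairwise (Function.onFun Disjoint A) := by
    refine (pairwise_disjoint_on A).2 fun i j hij => Set.disjoint_left.2 ?_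
    rintro p ⟨-, h1, h2⟩ ⟨h3, -, -⟩
    have : N (i + 1) ≤ N j := hN.monotone hij
    linarith
  calc ∑ j ∈ Finset.range K, ‖bfi f₁ f₂ (N j) (N (j + 1)) x‖ₑ
      ≤ ∑ j ∈ Finset.range K, ∫⁻ p in A j, ‖ftx f₁ p.1 * ftx f₂ p.2‖ₑ := by
        refine Finset.sum_le_sum fun j _ => (enorm_integral_le_lintegral_enorm _).trans_eq ?_
        refine lintegral_congr fun p => ?_
        rw [enorm_mul, ← ofReal_norm (Complex.exp _), norm_exp_I_mul_mul_add, ENNReal.ofReal_one,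
          mul_one]
    _ = ∫⁻ p in ⋃ j ∈ Finset.range K, A j, ‖ftx f₁ p.1 * ftx f₂ p.2‖ₑ :=
        (lintegral_biUnion_finset (hd.set_pairwise _)
          (fun j _ => measurableSet_simplex _ _) _).symm
    _ ≤ _ := setLIntegral_le_lintegral _ _

theorem Tr_lt_top {r : ℝ} (hr : 2 < r) (f₁ f₂ : 𝓢(ℝ, ℂ)) (x : ℝ) : Tr r f₁ f₂ x < ∞ := by
  set M := ∫⁻ p : ℝ × ℝ, ‖ftx f₁ p.1 * ftx f₂ p.2‖ₑ
  have hM : M < ∞ := (integrable_ftx_mul_ftx f₁ f₂).2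
  have hp : 0 ≤ r / 2 - 1 := by linarith
  refine lt_of_le_of_lt (b := (M ^ (r / 2 - 1) * M) ^ (2 / r)) ?_
    (ENNReal.rpow_lt_top_of_nonneg (by positivity)
      (ENNReal.mul_ne_top (ENNReal.rpow_ne_top_of_nonneg hp hM.ne) hM.ne))
  refine iSup_le fun K => iSup_le fun N => iSup_le fun hN => ?_
  refine ENNReal.rpow_le_rpow ?_ (by positivity)
  have hsum := sum_enorm_bfi_le f₁ f₂ K hN x
  calc _ ≤ ∑ j ∈ Finset.range K, M ^ (r / 2 - 1) * ‖bfi f₁ f₂ (N j) (N (j + 1)) x‖ₑ := by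
        refine Finset.sum_le_sum fun j hj => ?_
        rw [ofReal_norm]
        have hle : ‖bfi f₁ f₂ (N j) (N (j + 1)) x‖ₑ ≤ M :=
          (Finset.single_le_sum (f := fun j => ‖bfi f₁ f₂ (N j) (N (j + 1)) x‖ₑ)
            (fun _ _ => zero_le) hj).trans hsum
        calc ‖bfi f₁ f₂ (N j) (N (j + 1)) x‖ₑ ^ (r / 2)
            = ‖bfi f₁ f₂ (N j) (N (j + 1)) x‖ₑ ^ (r / 2 - 1)
                * ‖bfi f₁ f₂ (N j) (N (j + 1)) x‖ₑ ^ (1 : ℝ) := by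
              rw [← ENNReal.rpow_add_of_nonneg _ _ hp zero_le_one, sub_add_cancel]
          _ ≤ _ := by
              rw [ENNReal.rpow_one]
              gcongr
    _ ≤ _ := by
        rw [← Finset.mul_sum]
        gcongr

/-- The extremizing coefficients in the duality `ℓ^p`, `ℓ^{p'}` for `b₁, …, b_K`; when all the
`b_j` vanish, the unit mass is put at the index `0`. -/
def dualCoeff (p : ℝ) (K : ℕ) (b : ℕ → ℂ) (j : ℕ) : ℂ :=
  if ∑ i ∈ Finset.Icc 1 K, ‖b i‖ ^ p = 0 then (if j = 0 then 1 else 0)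
  else if j ∈ Finset.Icc 1 K then
    (starRingEnd ℂ) (b j) *
      ((‖b j‖ ^ (p - 2) * (∑ i ∈ Finset.Icc 1 K, ‖b i‖ ^ p) ^ (-((p - 1) / p)) : ℝ) : ℂ)
  else 0

theorem dualCoeff_of_lt {p : ℝ} {K : ℕ} (b : ℕ → ℂ) {j : ℕ} (hj : K < j) :
    dualCoeff p K b j = 0 := by
  have h0 : j ≠ 0 := by omega
  have h1 : j ∉ Finset.Icc 1 K := by simp; omega
  simp only [dualCoeff, h0, h1, if_false, ite_self]

theorem tsum_norm_dualCoeff_rpow {p : ℝ} (hp : 1 < p) (K : ℕ) (b : ℕ → ℂ) :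
    ∑' j, ‖dualCoeff p K b j‖ ^ (p / (p - 1)) = 1 := by
  have hq : p / (p - 1) ≠ 0 := (div_pos (by linarith) (by linarith)).ne'
  have hp1 : p - 1 ≠ 0 := by linarith
  by_cases hs : ∑ i ∈ Finset.Icc 1 K, ‖b i‖ ^ p = 0
  · rw [tsum_eq_single 0]
    · simp [dualCoeff, hs]
    · intro j hj
      simp [dualCoeff, hs, hj, Real.zero_rpow hq]
  · rw [tsum_eq_sum (s := Finset.Icc 1 K)]
    · set s := ∑ i ∈ Finset.Icc 1 K, ‖b i‖ ^ p with hsdef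
      have hs0 : 0 ≤ s := Finset.sum_nonneg fun i _ => by positivity
      have hterm : ∀ j ∈ Finset.Icc 1 K,
          ‖dualCoeff p K b j‖ ^ (p / (p - 1)) = ‖b j‖ ^ p * s⁻¹ := by
        intro j hj
        rw [dualCoeff, ← hsdef, if_neg hs, if_pos hj, norm_mul, RCLike.norm_conj,
          Complex.norm_real, Real.norm_of_nonneg (by positivity), ← mul_assoc]
        have h1 : ‖b j‖ * ‖b j‖ ^ (p - 2) = ‖b j‖ ^ (p - 1) := by
          rcases (norm_nonneg (b j)).eq_or_lt with h | h
          · rw [← h, zero_mul, Real.zero_rpow hp1]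
          · rw [← Real.rpow_one_add' h.le (by linarith)]
            congr 1; ring
        rw [h1, Real.mul_rpow (by positivity) (by positivity), ← Real.rpow_mul (norm_nonneg _),
          ← Real.rpow_mul hs0, ← Real.rpow_neg_one s]
        congr 2 <;> field_simp
      rw [Finset.sum_congr rfl hterm, ← Finset.sum_mul, ← hsdef, mul_inv_cancel₀ hs]
    · intro j hj
      simp only [dualCoeff, hs, hj, if_false, norm_zero, Real.zero_rpow hq]

theorem sum_dualCoeff_mul {p : ℝ} (hp : 1 < p) (K : ℕ) (b : ℕ → ℂ) :
    ∑ j ∈ Finset.Icc 1 K, dualCoeff p K b j * b j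
      = (((∑ j ∈ Finset.Icc 1 K, ‖b j‖ ^ p) ^ (1 / p) : ℝ) : ℂ) := by
  have hp0 : p ≠ 0 := by linarith
  by_cases hs : ∑ i ∈ Finset.Icc 1 K, ‖b i‖ ^ p = 0
  · rw [hs, Real.zero_rpow (by positivity), Complex.ofReal_zero]
    refine Finset.sum_eq_zero fun j hj => ?_
    have : j ≠ 0 := by simp at hj; omega
    simp [dualCoeff, hs, this]
  · set s := ∑ i ∈ Finset.Icc 1 K, ‖b i‖ ^ p with hsdef
    have hs0 : 0 < s := lt_of_le_of_ne (Finset.sum_nonneg fun i _ => by positivity) (Ne.symm hs)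
    have hterm : ∀ j ∈ Finset.Icc 1 K,
        dualCoeff p K b j * b j = ((‖b j‖ ^ p * s ^ (-((p - 1) / p)) : ℝ) : ℂ) := by
      intro j hj
      rw [dualCoeff, ← hsdef, if_neg hs, if_pos hj, mul_right_comm, mul_comm _ (b j),
        Complex.mul_conj, Complex.normSq_eq_norm_sq, ← Complex.ofReal_mul, ← mul_assoc]
      congr 2
      rcases (norm_nonneg (b j)).eq_or_lt with h | h
      · rw [← h, Real.zero_rpow hp0]; simp
      · rw [← Real.rpow_natCast, ← Real.rpow_add h]
        congr 1; push_cast; ring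
    rw [Finset.sum_congr rfl hterm, ← Complex.ofReal_sum, ← Finset.sum_mul, ← hsdef]
    congr 1
    nth_rewrite 1 [← Real.rpow_one s]
    rw [← Real.rpow_add hs0]
    congr 1
    field_simp
    ring

theorem measurable_dualCoeff (p : ℝ) (K : ℕ) {b : ℕ → ℝ → ℂ} (hb : ∀ j, Measurable (b j))
    (j : ℕ) : Measurable fun x => dualCoeff p K (fun i => b i x) j := by
  have hsum : Measurable fun x => ∑ i ∈ Finset.Icc 1 K, ‖b i x‖ ^ p :=
    Finset.measurable_sum _ fun i _ => (hb i).norm.pow_const p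
  unfold dualCoeff
  refine Measurable.ite (hsum (measurableSet_singleton 0)) measurable_const ?_
  split_ifs
  · refine (Complex.continuous_conj.measurable.comp (hb j)).mul
      (Complex.measurable_ofReal.comp (((hb j).norm.pow_const _).mul (hsum.pow_const _)))
  · exact measurable_const

/-- Linearization of `T_r`: there are measurable `K`, monotone `(N_j)` and
coefficients `(d_j)` with `Σ_j |d_j|^{r/(r-2)} ≡ 1`, vanishing for `j > K(x)`, so that
pointwise `T_r(f₁,f₂) ≤ C_r B_r(f₁,f₂)` where
`B_r(f₁,f₂)(x) = Σ_{j=1}^{K(x)} d_j(x) ∬_{N_{j-1}(x)<ξ₁<ξ₂<N_j(x)} f̂₁ f̂₂ e^{ix(ξ₁+ξ₂)}`. -/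
theorem statement2 (r : ℝ) (hr : 2 < r) :
    ∃ C : ℝ, 0 ≤ C ∧ ∀ f₁ f₂ : 𝓢(ℝ, ℂ),
      ∃ (K : ℝ → ℕ) (N : ℕ → ℝ → ℝ) (d : ℕ → ℝ → ℂ),
        Measurable K ∧ (∀ j, Measurable (N j)) ∧ (∀ j, Measurable (d j)) ∧
        (∀ x, Monotone fun j => N j x) ∧
        (∀ x, ∑' j : ℕ, ‖d j x‖ ^ (r / (r - 2)) = 1) ∧
        (∀ x, ∀ j : ℕ, K x < j → d j x = 0 ∧ N j x = N (j - 1) x) ∧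
        (∀ x : ℝ,
          Tr r (f₁ : ℝ → ℂ) (f₂ : ℝ → ℂ) x
            ≤ ENNReal.ofReal (C *
                ‖∑ j ∈ Finset.Icc 1 (K x),
                    d j x * bfi (f₁ : ℝ → ℂ) (f₂ : ℝ → ℂ) (N (j - 1) x) (N j x) x‖)) := by
  classical
  refine ⟨2, zero_le_two, fun f₁ f₂ => ?_⟩
  have hp : 1 < r / 2 := by linarith
  let S : ℕ × {N : ℕ → ℝ // StrictMono N} → ℝ → ℝ≥0∞ := fun i x =>
    (∑ j ∈ Finset.range i.1,
      (ENNReal.ofReal ‖bfi f₁ f₂ (i.2.1 j) (i.2.1 (j + 1)) x‖) ^ (r / 2)) ^ (2 / r)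
  have hS : ∀ i, Continuous (S i) := fun i =>
    ENNReal.continuous_rpow_const.comp <| continuous_finsetSum _ fun j _ =>
      ENNReal.continuous_rpow_const.comp <| ENNReal.continuous_ofReal.comp
        (continuous_bfi f₁ f₂ _ _).norm
  have hTr : ∀ x, Tr r f₁ f₂ x = ⨆ i, S i x := fun x => by
    simp only [Tr, S, iSup_prod, iSup_subtype]
  have : Nonempty (ℕ × {N : ℕ → ℝ // StrictMono N}) := ⟨0, _, Nat.strictMono_cast⟩
  obtain ⟨u, hu⟩ := exists_seq_iSup_eq_of_lowerSemicontinuous S fun i => (hS i).lowerSemicontinuous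
  have hTrm : Measurable (Tr r f₁ f₂) := by
    rw [funext fun x => (hTr x).trans (hu x)]
    exact Measurable.iSup fun n => (hS (u n)).measurable
  have hex : ∀ x, ∃ n, Tr r f₁ f₂ x ≤ 2 * S (u n) x := fun x => by
    by_contra! h
    have h2 : Tr r f₁ f₂ x ≤ Tr r f₁ f₂ x / 2 := by
      conv_lhs => rw [hTr, hu]
      refine iSup_le fun n => ?_
      rw [ENNReal.le_div_iff_mul_le (by simp) (by simp), mul_comm]
      exact (h n).le
    have h0 : Tr r f₁ f₂ x ≠ 0 := (zero_le.trans_lt (h 0)).ne'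
    exact (ENNReal.half_lt_self h0 (Tr_lt_top hr f₁ f₂ x).ne).not_ge h2
  have hset : ∀ n, MeasurableSet {x | Tr r f₁ f₂ x ≤ 2 * S (u n) x} := fun n =>
    measurableSet_le hTrm ((hS (u n)).measurable.const_mul 2)
  let b : ℕ → ℕ → ℝ → ℂ := fun n j => bfi f₁ f₂ ((u n).2.1 (j - 1)) ((u n).2.1 j)
  have hb : ∀ n j, Measurable (b n j) := fun n j => (continuous_bfi f₁ f₂ _ _).measurable
  let ν : ℝ → ℕ := fun x => Nat.find (hex x)
  refine ⟨fun x => (u (ν x)).1, fun j x => (u (ν x)).2.1 (min j (u (ν x)).1),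
    fun j x => dualCoeff (r / 2) (u (ν x)).1 (fun i => b (ν x) i x) j,
    ?_, fun j => ?_, fun j => ?_, fun x => ?_, fun x => ?_, fun x j hj => ⟨?_, ?_⟩, fun x => ?_⟩
  · exact Measurable.find (f := fun n _ => (u n).1) (fun _ => measurable_const) hset hex
  · exact Measurable.find (f := fun n _ => (u n).2.1 (min j (u n).1))
      (fun _ => measurable_const) hset hex
  · exact Measurable.find (f := fun n x => dualCoeff (r / 2) (u n).1 (fun i => b n i x) j)
      (fun n => measurable_dualCoeff _ _ (hb n) j) hset hex
  · exact fun i j hij => (u (ν x)).2.2.monotone (min_le_min_right _ hij)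
  · have hexp : r / (r - 2) = (r / 2) / (r / 2 - 1) := by
      have : r - 2 ≠ 0 := by linarith
      field_simp
    rw [hexp]
    exact tsum_norm_dualCoeff_rpow hp _ _
  · exact dualCoeff_of_lt _ hj
  · beta_reduce at hj
    have h1 : min j (u (ν x)).1 = (u (ν x)).1 := min_eq_right hj.le
    have h2 : min (j - 1) (u (ν x)).1 = (u (ν x)).1 := min_eq_right (by omega)
    simp only [h1, h2]
  · have hν : Tr r f₁ f₂ x ≤ 2 * S (u (ν x)) x := Nat.find_spec (hex x)
    beta_reduce
    generalize ν x = n at hν ⊢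
    have hsum : ∑ j ∈ Finset.Icc 1 (u n).1,
        dualCoeff (r / 2) (u n).1 (fun i => b n i x) j *
          bfi f₁ f₂ ((u n).2.1 (min (j - 1) (u n).1)) ((u n).2.1 (min j (u n).1)) x
        = (((∑ j ∈ Finset.Icc 1 (u n).1, ‖b n j x‖ ^ (r / 2)) ^ (1 / (r / 2)) : ℝ) : ℂ) := by
      rw [← sum_dualCoeff_mul hp]
      refine Finset.sum_congr rfl fun j hj => ?_
      obtain ⟨-, hj⟩ := Finset.mem_Icc.1 hj
      rw [min_eq_left hj, min_eq_left (by omega)]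
    have hSn : S (u n) x = ENNReal.ofReal
        ((∑ j ∈ Finset.Icc 1 (u n).1, ‖b n j x‖ ^ (r / 2)) ^ (1 / (r / 2))) := by
      rw [← ENNReal.ofReal_rpow_of_nonneg (Finset.sum_nonneg fun _ _ => by positivity)
        (by positivity), ENNReal.ofReal_sum_of_nonneg (fun _ _ => by positivity), one_div_div]
      simp only [S, b]
      congr 1
      refine Finset.sum_bij (fun j _ => j + 1) (fun j hj => ?_) (fun _ _ _ _ h => by omega)
        (fun j hj => ⟨j - 1, ?_⟩) (fun j _ => ?_)
      · simp at hj ⊢; omega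
      · simp at hj ⊢; omega
      · rw [Nat.add_sub_cancel, ENNReal.ofReal_rpow_of_nonneg (norm_nonneg _) (by positivity)]
    refine hν.trans_eq ?_
    rw [hsum, Complex.norm_real, Real.norm_of_nonneg (by positivity), ENNReal.ofReal_mul zero_le_two,
      hSn, ENNReal.ofReal_ofNat]

end
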